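/- There exists a constant C > 0 (depending on J, α and q) such that for every h ∈ (0, 1] and every (J+1)×(J+1) real matrix X, ‖W(h) X + X A(h)ᵀ − X‖ ≤ C·h^{2s}·‖X‖ in Frobenius norm. Consequently the Lyapunov–Sylvester operator L_{W(h),A(h)} converges uniformly (in operator norm) to the identity as h → 0⁺. -/

import Mathlib

open Matrix

attribute [local instance] Matrix.frobeniusNormedAddCommGroup

/-- The (J+1)×(J+1) matrix `A(h)` of the scheme. -/
noncomputable def Amat (J : ℕ) (α s h : ℝ) : Matrix (Fin (J + 1)) (Fin (J + 1)) ℝ :=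
  Matrix.of fun i j : Fin (J + 1) =>
    if (i : ℕ) = (j : ℕ) then 1 / 2 + 2 * α * h ^ ((2 : ℝ) + 2 * s)
    else if ((i : ℕ) = 0 ∧ (j : ℕ) = 1) ∨ ((i : ℕ) = J ∧ (j : ℕ) = J - 1) then
      2 * (-(α * h ^ ((2 : ℝ) + 2 * s)))
    else if (i : ℕ) + 1 = (j : ℕ) ∨ (j : ℕ) + 1 = (i : ℕ) then
      -(α * h ^ ((2 : ℝ) + 2 * s))
    else 0

/-- The (J+1)×(J+1) matrix `R`. -/
def Rmat (J : ℕ) : Matrix (Fin (J + 1)) (Fin (J + 1)) ℝ :=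
  Matrix.of fun i j : Fin (J + 1) =>
    if (i : ℕ) = (j : ℕ) then -2
    else if ((i : ℕ) = 0 ∧ (j : ℕ) = 1) ∨ ((i : ℕ) = J ∧ (j : ℕ) = J - 1) then 2
    else if (i : ℕ) + 1 = (j : ℕ) ∨ (j : ℕ) + 1 = (i : ℕ) then 1
    else 0

/-- `W(h) = A(h) + ω R²`, where `ω = 2a₂c₂ = −2α²q·h^(2s)`. -/
noncomputable def Wmat (J : ℕ) (α q s h : ℝ) : Matrix (Fin (J + 1)) (Fin (J + 1)) ℝ :=
  Amat J α s h + (-2 * α ^ 2 * q * h ^ ((2 : ℝ) * s)) • (Rmat J * Rmat J)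

theorem Amat_eq (J : ℕ) (α s h : ℝ) :
    Amat J α s h =
      (1 / 2 : ℝ) • (1 : Matrix (Fin (J + 1)) (Fin (J + 1)) ℝ) -
        (α * h ^ ((2 : ℝ) + 2 * s)) • Rmat J := by
  ext i j
  simp only [Amat, Rmat, Matrix.of_apply, Matrix.sub_apply, Matrix.smul_apply, Matrix.one_apply,
    smul_eq_mul, Fin.ext_iff]
  split_ifs <;> ring

theorem Wmat_mul_add_mul_Amat_transpose_sub (J : ℕ) (α q s h : ℝ)
    (X : Matrix (Fin (J + 1)) (Fin (J + 1)) ℝ) :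
    Wmat J α q s h * X + X * (Amat J α s h)ᵀ - X =
      (-(α * h ^ ((2 : ℝ) + 2 * s))) • (Rmat J * X + X * (Rmat J)ᵀ) +
        (-2 * α ^ 2 * q * h ^ ((2 : ℝ) * s)) • (Rmat J * Rmat J * X) := by
  rw [Wmat, Amat_eq]
  simp only [Matrix.transpose_sub, Matrix.transpose_smul, Matrix.transpose_one, Matrix.add_mul,
    Matrix.sub_mul, Matrix.mul_sub, Matrix.smul_mul, Matrix.mul_smul, Matrix.one_mul,
    Matrix.mul_one]
  module

attribute [local instance] Matrix.frobeniusNormedSpace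

theorem norm_Wmat_mul_add_mul_Amat_transpose_sub_le (J : ℕ) (α q s : ℝ) {h : ℝ} (h0 : 0 < h)
    (h1 : h ≤ 1) (X : Matrix (Fin (J + 1)) (Fin (J + 1)) ℝ) :
    ‖Wmat J α q s h * X + X * (Amat J α s h)ᵀ - X‖ ≤
      (|α| * (2 * ‖Rmat J‖) + 2 * α ^ 2 * |q| * ‖Rmat J * Rmat J‖) *
        h ^ ((2 : ℝ) * s) * ‖X‖ := by
  have hσ : h ^ ((2 : ℝ) + 2 * s) ≤ h ^ ((2 : ℝ) * s) :=
    Real.rpow_le_rpow_of_exponent_ge h0 h1 (by linarith)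
  have hσ0 : 0 < h ^ ((2 : ℝ) + 2 * s) := Real.rpow_pos_of_pos h0 _
  have hτ0 : 0 < h ^ ((2 : ℝ) * s) := Real.rpow_pos_of_pos h0 _
  have hR : ‖Rmat J * X + X * (Rmat J)ᵀ‖ ≤ 2 * ‖Rmat J‖ * ‖X‖ := by
    have hl := Matrix.frobenius_norm_mul (Rmat J) X
    have hr := Matrix.frobenius_norm_mul X (Rmat J)ᵀ
    rw [Matrix.frobenius_norm_transpose] at hr
    linarith [norm_add_le (Rmat J * X) (X * (Rmat J)ᵀ)]
  have hRR := Matrix.frobenius_norm_mul (Rmat J * Rmat J) X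
  rw [Wmat_mul_add_mul_Amat_transpose_sub]
  calc _ ≤ |α| * h ^ ((2 : ℝ) + 2 * s) * ‖Rmat J * X + X * (Rmat J)ᵀ‖ +
        2 * α ^ 2 * |q| * h ^ ((2 : ℝ) * s) * ‖Rmat J * Rmat J * X‖ := by
        refine (norm_add_le _ _).trans_eq ?_
        simp only [norm_smul, Real.norm_eq_abs, abs_mul, abs_neg, abs_pow, sq_abs,
          abs_of_pos hσ0, abs_of_pos hτ0, abs_two]
    _ ≤ |α| * h ^ ((2 : ℝ) * s) * (2 * ‖Rmat J‖ * ‖X‖) +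
        2 * α ^ 2 * |q| * h ^ ((2 : ℝ) * s) * (‖Rmat J * Rmat J‖ * ‖X‖) := by
        gcongr
    _ = _ := by ring

/-- There is `C > 0` with `‖W(h) X + X A(h)ᵀ − X‖ ≤ C h^(2s) ‖X‖` (Frobenius norm)
for all `h ∈ (0,1]` and all `X`; consequently the Lyapunov–Sylvester operator
`L_{W(h),A(h)}` converges uniformly (in operator norm) to the identity as `h → 0⁺`. -/
theorem lyapunov_operator_tendsto_id (J : ℕ) (hJ : 4 ≤ J) (α q s : ℝ) (hs : 0 < s) :
    (∃ C : ℝ, 0 < C ∧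
      ∀ h : ℝ, 0 < h → h ≤ 1 → ∀ X : Matrix (Fin (J + 1)) (Fin (J + 1)) ℝ,
        ‖Wmat J α q s h * X + X * (Amat J α s h)ᵀ - X‖ ≤
          C * h ^ ((2 : ℝ) * s) * ‖X‖) ∧
    ∀ ε : ℝ, 0 < ε → ∃ h₀ : ℝ, 0 < h₀ ∧ ∀ h : ℝ, 0 < h → h < h₀ →
      ∀ X : Matrix (Fin (J + 1)) (Fin (J + 1)) ℝ,
        ‖Wmat J α q s h * X + X * (Amat J α s h)ᵀ - X‖ ≤ ε * ‖X‖ := by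
  obtain ⟨C, hC, hbound⟩ : ∃ C : ℝ, 0 < C ∧
      ∀ h : ℝ, 0 < h → h ≤ 1 → ∀ X : Matrix (Fin (J + 1)) (Fin (J + 1)) ℝ,
        ‖Wmat J α q s h * X + X * (Amat J α s h)ᵀ - X‖ ≤
          C * h ^ ((2 : ℝ) * s) * ‖X‖ := by
    refine ⟨|α| * (2 * ‖Rmat J‖) + 2 * α ^ 2 * |q| * ‖Rmat J * Rmat J‖ + 1, by positivity,
      fun h h0 h1 X => ?_⟩
    refine (norm_Wmat_mul_add_mul_Amat_transpose_sub_le J α q s h0 h1 X).trans ?_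
    have hle := (lt_add_one (|α| * (2 * ‖Rmat J‖) + 2 * α ^ 2 * |q| * ‖Rmat J * Rmat J‖)).le
    exact mul_le_mul_of_nonneg_right (mul_le_mul_of_nonneg_right hle (by positivity))
      (norm_nonneg X)
  refine ⟨⟨C, hC, hbound⟩, fun ε hε => ?_⟩
  refine ⟨min 1 ((ε / C) ^ ((2 : ℝ) * s)⁻¹), by positivity, fun h h0 hlt X => ?_⟩
  refine (hbound h h0 (hlt.le.trans (min_le_left _ _)) X).trans ?_
  gcongr
  have hpow : h ^ ((2 : ℝ) * s) ≤ ε / C :=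
    (Real.le_rpow_inv_iff_of_pos h0.le (by positivity) (by positivity)).1
      (hlt.le.trans (min_le_right _ _))
  rwa [le_div_iff₀' hC] at hpow
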